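/- arXiv:1502.05994 — 3 statements merged into one kernel-verified Lean document; each statement's English description precedes it below -/
import Mathlib

section
/- Let $s, N$ be positive integers, $l < k$ integers, and let $f_l, \ldots, f_k$ be trigonometric polynomials on $\mathbb{T}^d$ each of degree at most $s$ with respect to the last variable (i.e. $\widehat{f_j}(\lambda) = 0$ whenever $|\lambda_d| > s$). Define $w_d(y', z) = \sum_{j=l}^{k} e^{2\pi i N j z} f_j(y', z)$ on $\mathbb{T}^d$ and $w_{d+1}(y', y_d, z) = \sum_{j=l}^{k} e^{2\pi i j y_d} f_j(y', z)$ on $\mathbb{T}^{d+1}$, where $(y', z) \in \mathbb{T}^{d-1} \times \mathbb{T}$. Then $\Big(1 - 2(k-l+1)\frac{s}{N}\Big) \|w_{d+1}\|_{L^1(\mathbb{T}^{d+1})} \le \|w_d\|_{L^1(\mathbb{T}^d)} \le \Big(1 + 2(k-l+1)\frac{s}{N}\Big) \|w_{d+1}\|_{L^1(\mathbb{T}^{d+1})}$. -/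
open MeasureTheory Finset

/-- If `ζ` runs through the `2 * s`-th roots of `-1`, the weights `4 / ‖1 - ζ‖ ^ 2` have moments
`4 * s * (s - n)` for `n ≤ 2 * s`. -/
theorem sum_riesz_moments {s : ℕ} (hs : 0 < s) (ζ : ℕ → ℂ) (hnorm : ∀ k, ‖ζ k‖ = 1)
    (hpow : ∀ k, ζ k ^ (2 * s) = -1)
    (hsum : ∀ n, 0 < n → n < 2 * s → ∑ k ∈ range (2 * s), ζ k ^ n = 0) (n : ℕ) (hn : n ≤ 2 * s) :
    ∑ k ∈ range (2 * s), ((4 / ‖1 - ζ k‖ ^ 2 : ℝ) : ℂ) * ζ k ^ n = 4 * s * (s - n) := by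
  set S : ℕ → ℂ := fun n => ∑ k ∈ range (2 * s), ((4 / ‖1 - ζ k‖ ^ 2 : ℝ) : ℂ) * ζ k ^ n with hS
  have hrec : ∀ n, S (n + 2) - 2 * S (n + 1) + S n = -4 * ∑ k ∈ range (2 * s), ζ k ^ (n + 1) := by
    intro n
    simp only [hS, mul_sum]
    rw [← sum_sub_distrib, ← sum_add_distrib]
    refine sum_congr rfl fun k _ => ?_
    have h1 : 1 - ζ k ≠ 0 := by
      intro h
      have h2 := hpow k
      rw [← sub_eq_zero.mp h, one_pow] at h2
      norm_num at h2
    have hc : ζ k * (starRingEnd ℂ) (ζ k) = 1 := by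
      rw [Complex.mul_conj, Complex.normSq_eq_norm_sq, hnorm]; norm_num
    have hn2 : ((‖1 - ζ k‖ ^ 2 : ℝ) : ℂ) = (1 - ζ k) * (1 - (starRingEnd ℂ) (ζ k)) := by
      rw [← Complex.normSq_eq_norm_sq, ← Complex.mul_conj]; simp
    have hne : ((‖1 - ζ k‖ ^ 2 : ℝ) : ℂ) ≠ 0 := by
      simpa using h1
    have key : ((4 / ‖1 - ζ k‖ ^ 2 : ℝ) : ℂ) * (ζ k ^ 2 - 2 * ζ k + 1) = -4 * ζ k := by
      rw [Complex.ofReal_div, div_mul_eq_mul_div, div_eq_iff hne, hn2]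
      push_cast
      linear_combination 4 * (ζ k - 1) * hc
    linear_combination ζ k ^ n * key
  have hanti : ∀ n, S (n + 2 * s) = - S n := by
    intro n
    simp only [hS, ← sum_neg_distrib]
    refine sum_congr rfl fun k _ => ?_
    rw [pow_add, hpow]; ring
  have hd : ∀ n, n < 2 * s → S (n + 1) - S n = S 1 - S 0 := by
    intro n
    induction n with
    | zero => intro; simp
    | succ n ih =>
      intro h
      have h3 := hrec n
      rw [hsum (n + 1) (by omega) h] at h3
      linear_combination ih (by omega) + h3
  have hlin : ∀ n, n ≤ 2 * s → S n = S 0 + n * (S 1 - S 0) := by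
    intro n
    induction n with
    | zero => intro; simp
    | succ n ih =>
      intro h
      push_cast
      linear_combination ih (by omega) + hd n (by omega)
  obtain ⟨t, ht⟩ : ∃ t, 2 * s = t + 1 := ⟨2 * s - 1, by omega⟩
  have hd0 : S 1 - S 0 = -4 * s := by
    have h4 := hrec t
    have h5 : t + 2 = 1 + 2 * s := by omega
    have h6 : t + 1 = 0 + 2 * s := by omega
    have h7 := hd t (by omega)
    rw [h5, h6, hanti, hanti] at h4
    rw [h6, hanti] at h7
    simp only [zero_add, hpow] at h4
    simp at h4
    linear_combination (-1 / 2) * h4 + (-1 / 2) * h7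
  have hS0 : S 0 = 4 * s ^ 2 := by
    have h4 := hlin (2 * s) le_rfl
    have h5 := hanti 0
    rw [zero_add] at h5
    rw [h5, hd0] at h4
    push_cast at h4
    linear_combination (-1 / 2) * h4
  change S n = _
  rw [hlin n hn, hd0, hS0]; ring

/-- M. Riesz's interpolation formula: on frequencies at most `s`, multiplication by the frequency
is a combination of translations with coefficients of total mass `s`. -/
theorem exists_riesz_weights {s : ℕ} (hs : 0 < s) :
    ∃ (x : ℕ → AddCircle (1 : ℝ)) (b : ℕ → ℂ), ∑ k ∈ range (2 * s), ‖b k‖ = s ∧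
      ∀ p : ℤ, |p| ≤ s → ∑ k ∈ range (2 * s), b k * fourier p (x k) = p := by
  let x : ℕ → AddCircle (1 : ℝ) := fun k => (((2 * k + 1) / (4 * s) : ℝ) : AddCircle (1 : ℝ))
  have hs0 : (s : ℂ) ≠ 0 := by exact_mod_cast hs.ne'
  have hs1 : (s : ℝ) ≠ 0 := by exact_mod_cast hs.ne'
  have hx : ∀ (k n : ℕ), fourier (n : ℤ) (x k) = fourier 1 (x k) ^ n := by
    intro k n
    induction n with
    | zero => simp
    | succ n ih => push_cast; rw [fourier_add, ih, pow_succ]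
  have hexp : ∀ k, fourier 1 (x k) =
      Complex.exp (2 * Real.pi * Complex.I / (4 * s : ℕ)) *
        Complex.exp (2 * Real.pi * Complex.I / (2 * s : ℕ)) ^ k := by
    intro k
    rw [fourier_coe_apply, ← Complex.exp_nat_mul, ← Complex.exp_add]
    congr 1
    push_cast
    field_simp
    ring
  have hnorm : ∀ (n : ℤ) k, ‖fourier n (x k)‖ = 1 := by
    intro n k
    rw [fourier_apply]; exact Circle.norm_coe _
  have hprim : IsPrimitiveRoot (Complex.exp (2 * Real.pi * Complex.I / (2 * s : ℕ))) (2 * s) :=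
    Complex.isPrimitiveRoot_exp _ (by omega)
  have hmom := sum_riesz_moments hs (fun k => fourier 1 (x k)) (hnorm 1) (fun k => by
      rw [hexp, mul_pow, ← pow_mul, mul_comm k, pow_mul _ (2 * s) k, hprim.pow_eq_one, one_pow,
        mul_one, ← Complex.exp_nat_mul, ← Complex.exp_pi_mul_I]
      congr 1
      push_cast
      field_simp
      ring) (fun n h0 hn => by
      simp only [hexp, mul_pow, ← mul_sum, ← pow_mul]
      have h1 : Complex.exp (2 * Real.pi * Complex.I / (2 * s : ℕ)) ^ n ≠ 1 :=
        hprim.pow_ne_one_of_pos_of_lt h0.ne' hn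
      simp only [mul_comm _ n, pow_mul]
      rw [geom_sum_eq h1, ← pow_mul, mul_comm n, pow_mul, hprim.pow_eq_one]
      simp)
  refine ⟨x, fun k => -(1 / (4 * s)) * ((4 / ‖1 - fourier 1 (x k)‖ ^ 2 : ℝ) : ℂ) *
    fourier (s : ℤ) (x k), ?_, ?_⟩
  · have h0 := hmom 0 (by omega)
    simp only [pow_zero, mul_one, Nat.cast_zero, sub_zero] at h0
    have h0' : ∑ k ∈ range (2 * s), (4 / ‖1 - fourier 1 (x k)‖ ^ 2 : ℝ) = 4 * s * s := by
      exact_mod_cast h0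
    have : ∀ k, ‖-(1 / (4 * (s : ℂ))) * ((4 / ‖1 - fourier 1 (x k)‖ ^ 2 : ℝ) : ℂ) *
        fourier (s : ℤ) (x k)‖ = 1 / (4 * s) * (4 / ‖1 - fourier 1 (x k)‖ ^ 2 : ℝ) := by
      intro k
      rw [norm_mul, norm_mul, hnorm, Complex.norm_real, norm_neg, mul_one,
        Real.norm_of_nonneg (by positivity)]
      simp
    rw [sum_congr rfl fun k _ => this k, ← mul_sum, h0']
    field_simp
  · intro p hp
    obtain ⟨hp1, hp2⟩ := abs_le.mp hp
    obtain ⟨n, hn⟩ := Int.eq_ofNat_of_zero_le (show 0 ≤ (s : ℤ) + p by omega)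
    have h1 := hmom n (by omega)
    have hnc : (n : ℂ) = s + p := by exact_mod_cast hn.symm
    have : ∀ k, -(1 / (4 * (s : ℂ))) * ((4 / ‖1 - fourier 1 (x k)‖ ^ 2 : ℝ) : ℂ) *
        fourier (s : ℤ) (x k) * fourier p (x k) = -(1 / (4 * (s : ℂ))) *
        (((4 / ‖1 - fourier 1 (x k)‖ ^ 2 : ℝ) : ℂ) * fourier 1 (x k) ^ n) := by
      intro k
      rw [← hx, ← hn, fourier_add]; ring
    rw [sum_congr rfl fun k _ => this k, ← mul_sum, h1, hnc]
    field_simp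
    ring

theorem abs_norm_sub_integral_norm_le {g g' : ℝ → ℂ} (hg : ∀ θ, HasDerivAt g (g' θ) θ)
    (hg' : Continuous g') :
    |‖g 0‖ - ∫ θ in (-1 / 2 : ℝ)..(1 / 2), ‖g θ‖| ≤
      1 / 2 * ∫ θ in (-1 / 2 : ℝ)..(1 / 2), ‖g' θ‖ := by
  have hgc : Continuous g := continuous_iff_continuousAt.mpr fun θ => (hg θ).continuousAt
  have hi : ∀ a b : ℝ, IntervalIntegrable (fun θ => ‖g' θ‖) volume a b :=
    fun a b => hg'.norm.intervalIntegrable a b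
  have hd : ∀ a b : ℝ, IntervalIntegrable (fun θ => |‖g 0‖ - ‖g θ‖|) volume a b :=
    fun a b => Continuous.intervalIntegrable (by fun_prop) a b
  have hn : ∀ a b : ℝ, IntervalIntegrable (fun θ => ‖g θ‖) volume a b :=
    fun a b => hgc.norm.intervalIntegrable a b
  have hftc : ∀ θ, |‖g 0‖ - ‖g θ‖| ≤ |∫ t in (0 : ℝ)..θ, ‖g' t‖| := by
    intro θ
    have h1 := intervalIntegral.integral_eq_sub_of_hasDerivAt (a := 0) (b := θ)
      (fun x _ => hg x) (hg'.intervalIntegrable _ _)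
    rw [abs_sub_comm]
    refine (abs_norm_sub_norm_le _ _).trans ?_
    rw [← h1]
    exact intervalIntegral.norm_integral_le_abs_integral_norm
  have hnn : ∀ a b : ℝ, a ≤ b → 0 ≤ ∫ t in a..b, ‖g' t‖ := fun a b h =>
    intervalIntegral.integral_nonneg h fun _ _ => norm_nonneg _
  have hright : ∫ θ in (0 : ℝ)..(1 / 2), |‖g 0‖ - ‖g θ‖| ≤
      1 / 2 * ∫ θ in (0 : ℝ)..(1 / 2), ‖g' θ‖ := by
    refine (intervalIntegral.integral_mono_on (by norm_num) (hd _ _)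
      (intervalIntegrable_const (c := ∫ t in (0 : ℝ)..(1 / 2), ‖g' t‖)) fun θ hθ => ?_).trans ?_
    · refine (hftc θ).trans ?_
      rw [abs_of_nonneg (hnn _ _ hθ.1),
        ← intervalIntegral.integral_add_adjacent_intervals (hi 0 θ) (hi θ (1 / 2))]
      linarith [hnn _ _ hθ.2]
    · rw [intervalIntegral.integral_const]; norm_num
  have hleft : ∫ θ in (-1 / 2 : ℝ)..0, |‖g 0‖ - ‖g θ‖| ≤
      1 / 2 * ∫ θ in (-1 / 2 : ℝ)..0, ‖g' θ‖ := by
    refine (intervalIntegral.integral_mono_on (by norm_num) (hd _ _)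
      (intervalIntegrable_const (c := ∫ t in (-1 / 2 : ℝ)..0, ‖g' t‖)) fun θ hθ => ?_).trans ?_
    · refine (hftc θ).trans ?_
      rw [intervalIntegral.integral_symm, abs_neg, abs_of_nonneg (hnn _ _ hθ.2),
        ← intervalIntegral.integral_add_adjacent_intervals (hi (-1 / 2) θ) (hi θ 0)]
      linarith [hnn _ _ hθ.1]
    · rw [intervalIntegral.integral_const]; norm_num
  have hmean : ‖g 0‖ - ∫ θ in (-1 / 2 : ℝ)..(1 / 2), ‖g θ‖ =
      ∫ θ in (-1 / 2 : ℝ)..(1 / 2), (‖g 0‖ - ‖g θ‖) := by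
    rw [intervalIntegral.integral_sub intervalIntegrable_const (hn _ _),
      intervalIntegral.integral_const]
    norm_num
  rw [hmean]
  refine (intervalIntegral.abs_integral_le_integral_abs (by norm_num)).trans ?_
  rw [← intervalIntegral.integral_add_adjacent_intervals (hd (-1 / 2) 0) (hd 0 (1 / 2)),
    ← intervalIntegral.integral_add_adjacent_intervals (hi (-1 / 2) 0) (hi 0 (1 / 2))]
  linarith

theorem integrable_of_continuous_of_compactSpace {X E : Type*} [TopologicalSpace X] [CompactSpace X]
    [MeasureSpace X] [OpensMeasurableSpace X] [IsFiniteMeasure (volume : Measure X)]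
    [NormedAddCommGroup E] [SecondCountableTopology E] {f : X → E} (hf : Continuous f) :
    Integrable f :=
  hf.integrable_of_hasCompactSupport (HasCompactSupport.of_compactSpace f)

section Transference

variable {Y : Type*} [TopologicalSpace Y] [CompactSpace Y] [SecondCountableTopology Y]
  [MeasureSpace Y] [BorelSpace Y] [IsFiniteMeasure (volume : Measure Y)]

theorem integral_prod_add_right {Φ : Y × AddCircle (1 : ℝ) → ℝ} (hΦ : Continuous Φ)
    (c : AddCircle (1 : ℝ)) : ∫ p : Y × AddCircle (1 : ℝ), Φ (p.1, p.2 + c) = ∫ p, Φ p := by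
  rw [Measure.volume_eq_prod,
    integral_prod _ (integrable_of_continuous_of_compactSpace (by fun_prop)),
    integral_prod _ (integrable_of_continuous_of_compactSpace hΦ)]
  refine integral_congr_ae (.of_forall fun y => ?_)
  exact integral_add_right_eq_self (fun z => Φ (y, z)) c

/-- Averaging over the translates of the curve `u = N z` in the `z` direction recovers the integral
over the whole product. -/
theorem integral_diagonal_average {N : ℕ} (hN : 0 < N)
    {Φ : (Y × AddCircle (1 : ℝ)) × AddCircle (1 : ℝ) → ℝ} (hΦ : Continuous Φ) :
    ∫ p : Y × AddCircle (1 : ℝ), ∫ θ in (-1 / 2 : ℝ)..(1 / 2),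
      Φ ((p.1, p.2 + ((θ / N : ℝ) : AddCircle (1 : ℝ))), N • p.2) = ∫ q, Φ q := by
  obtain ⟨C, hC⟩ := isCompact_univ.exists_bound_of_continuousOn hΦ.continuousOn
  have hcoe : Continuous fun θ : ℝ => (θ : AddCircle (1 : ℝ)) := AddCircle.continuous_mk' 1
  have : IsFiniteMeasure (volume.restrict (Set.uIoc (-1 / 2 : ℝ) (1 / 2))) :=
    ⟨by rw [Measure.restrict_apply_univ, Set.uIoc_of_le (by norm_num)]; exact measure_Ioc_lt_top⟩
  have hN' : (N : ℝ) ≠ 0 := by exact_mod_cast hN.ne'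
  rw [← intervalIntegral_integral_swap, intervalIntegral.integral_congr (g := fun θ =>
      ∫ p : Y × AddCircle (1 : ℝ), Φ (p, N • p.2 - (θ : AddCircle (1 : ℝ))))]
  · rw [intervalIntegral_integral_swap,
      Measure.volume_eq_prod (Y × AddCircle (1 : ℝ)) (AddCircle (1 : ℝ)),
      integral_prod _ (integrable_of_continuous_of_compactSpace hΦ)]
    · refine integral_congr_ae (.of_forall fun p => ?_)
      have h1 := UnitAddCircle.intervalIntegral_preimage (-1 / 2)
        (fun u => Φ (p, N • p.2 - u))
      rw [show (-1 / 2 + 1 : ℝ) = 1 / 2 by norm_num] at h1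
      exact h1.trans (integral_sub_left_eq_self (fun u => Φ (p, u)) volume (N • p.2))
    · refine Integrable.of_bound (C := C) (Continuous.aestronglyMeasurable ?_)
        (.of_forall fun _ => hC _ trivial)
      fun_prop
  · intro θ _
    have h1 := integral_prod_add_right (Y := Y)
      (Φ := fun p => Φ (p, N • p.2 - (θ : AddCircle (1 : ℝ)))) (by fun_prop)
      ((θ / N : ℝ) : AddCircle (1 : ℝ))
    simp only at h1 ⊢
    rw [← h1]
    refine integral_congr_ae (.of_forall fun p => ?_)
    have h2 : N • ((θ / N : ℝ) : AddCircle (1 : ℝ)) = (θ : AddCircle (1 : ℝ)) := by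
      rw [← AddCircle.coe_nsmul, nsmul_eq_mul, mul_div_cancel₀ _ hN']
    simp only [smul_add, h2, add_sub_cancel_right]
  · refine Integrable.of_bound (C := C) (Continuous.aestronglyMeasurable ?_)
      (.of_forall fun _ => hC _ trivial)
    fun_prop

/-- Bernstein's inequality in `L¹`, in the variable `z` of a function
`∑ i ∈ I, A i (y, u) * fourier (p i) z` of frequencies `p i` at most `s`. -/
theorem integral_norm_bernstein {ι : Type*} {s : ℕ} (hs : 0 < s) (I : Finset ι)
    {A : ι → Y × AddCircle (1 : ℝ) → ℂ} (hA : ∀ i, Continuous (A i)) {p : ι → ℤ}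
    (hp : ∀ i ∈ I, |p i| ≤ s) :
    ∫ q : (Y × AddCircle (1 : ℝ)) × AddCircle (1 : ℝ),
        ‖∑ i ∈ I, A i (q.1.1, q.2) * (p i * fourier (p i) q.1.2)‖ ≤
      s * ∫ q : (Y × AddCircle (1 : ℝ)) × AddCircle (1 : ℝ),
        ‖∑ i ∈ I, A i (q.1.1, q.2) * fourier (p i) q.1.2‖ := by
  obtain ⟨x, b, hb, hx⟩ := exists_riesz_weights hs
  set G : (Y × AddCircle (1 : ℝ)) × AddCircle (1 : ℝ) → ℂ :=
    fun q => ∑ i ∈ I, A i (q.1.1, q.2) * fourier (p i) q.1.2 with hG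
  have hGc : Continuous G := by fun_prop
  have hshift : ∀ c, ∫ q : (Y × AddCircle (1 : ℝ)) × AddCircle (1 : ℝ),
      ‖G ((q.1.1, q.1.2 + c), q.2)‖ = ∫ q, ‖G q‖ := by
    intro c
    rw [Measure.volume_eq_prod (Y × AddCircle (1 : ℝ)) (AddCircle (1 : ℝ)),
      integral_prod_symm _ (integrable_of_continuous_of_compactSpace (by fun_prop)),
      integral_prod_symm _ (integrable_of_continuous_of_compactSpace (by fun_prop))]
    refine integral_congr_ae (.of_forall fun u => ?_)
    exact integral_prod_add_right (Φ := fun r => ‖G (r, u)‖) (by fun_prop) c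
  have hpt : ∀ q : (Y × AddCircle (1 : ℝ)) × AddCircle (1 : ℝ),
      ∑ i ∈ I, A i (q.1.1, q.2) * (p i * fourier (p i) q.1.2) =
        ∑ k ∈ range (2 * s), b k * G ((q.1.1, q.1.2 + x k), q.2) := by
    intro q
    simp only [hG, mul_sum]
    rw [sum_comm]
    refine sum_congr rfl fun i hi => ?_
    rw [← hx (p i) (hp i hi), sum_mul, mul_sum]
    refine sum_congr rfl fun k _ => ?_
    rw [fourier_apply, fourier_apply, fourier_apply, smul_add, AddCircle.toCircle_add]
    push_cast
    ring
  calc ∫ q : (Y × AddCircle (1 : ℝ)) × AddCircle (1 : ℝ),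
        ‖∑ i ∈ I, A i (q.1.1, q.2) * (p i * fourier (p i) q.1.2)‖
      ≤ ∫ q : (Y × AddCircle (1 : ℝ)) × AddCircle (1 : ℝ),
          ∑ k ∈ range (2 * s), ‖b k‖ * ‖G ((q.1.1, q.1.2 + x k), q.2)‖ := by
        refine integral_mono (integrable_of_continuous_of_compactSpace (by fun_prop))
          (integrable_of_continuous_of_compactSpace (by fun_prop)) fun q => ?_
        simp only [hpt]
        exact (norm_sum_le _ _).trans_eq (sum_congr rfl fun k _ => norm_mul _ _)
    _ = s * ∫ q, ‖G q‖ := by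
        rw [integral_finsetSum _ fun k _ => integrable_of_continuous_of_compactSpace (by fun_prop)]
        simp only [integral_const_mul, hshift, ← sum_mul, hb]

/-- Restricting a function of `z`-frequencies at most `s` to the curve `u = N z` changes its
`L¹` norm by a relative error of at most `π s / N`. -/
theorem abs_integral_norm_diagonal_sub_le {ι : Type*} {s N : ℕ} (hs : 0 < s) (hN : 0 < N)
    (I : Finset ι) {A : ι → Y × AddCircle (1 : ℝ) → ℂ} (hA : ∀ i, Continuous (A i)) {p : ι → ℤ}
    (hp : ∀ i ∈ I, |p i| ≤ s) {G : (Y × AddCircle (1 : ℝ)) × AddCircle (1 : ℝ) → ℂ}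
    (hG : ∀ q, G q = ∑ i ∈ I, A i (q.1.1, q.2) * fourier (p i) q.1.2) :
    |(∫ r : Y × AddCircle (1 : ℝ), ‖G (r, N • r.2)‖) - ∫ q, ‖G q‖| ≤
      Real.pi * s / N * ∫ q, ‖G q‖ := by
  have hN' : (0 : ℝ) < N := by exact_mod_cast hN
  have hcoe : Continuous fun θ : ℝ => (θ : AddCircle (1 : ℝ)) := AddCircle.continuous_mk' 1
  have hGc : Continuous G := by
    rw [funext hG]; fun_prop
  set H : (Y × AddCircle (1 : ℝ)) × AddCircle (1 : ℝ) → ℂ :=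
    fun q => ∑ i ∈ I, A i (q.1.1, q.2) * (p i * fourier (p i) q.1.2) with hH
  have hHc : Continuous H := by fun_prop
  have hbern : ∫ q, ‖H q‖ ≤ s * ∫ q, ‖G q‖ := by
    rw [funext hG]; exact integral_norm_bernstein hs I hA hp
  have hint_avg : ∀ {Φ : (Y × AddCircle (1 : ℝ)) × AddCircle (1 : ℝ) → ℝ}, Continuous Φ →
      Integrable fun r : Y × AddCircle (1 : ℝ) => ∫ θ in (-1 / 2 : ℝ)..(1 / 2),
        Φ ((r.1, r.2 + ((θ / N : ℝ) : AddCircle (1 : ℝ))), N • r.2) := fun hΦ =>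
    integrable_of_continuous_of_compactSpace <|
      intervalIntegral.continuous_parametric_intervalIntegral_of_continuous' (by fun_prop) _ _
  have hpt : ∀ r : Y × AddCircle (1 : ℝ), |‖G (r, N • r.2)‖ - ∫ θ in (-1 / 2 : ℝ)..(1 / 2),
        ‖G ((r.1, r.2 + ((θ / N : ℝ) : AddCircle (1 : ℝ))), N • r.2)‖| ≤
      Real.pi / N * ∫ θ in (-1 / 2 : ℝ)..(1 / 2),
        ‖H ((r.1, r.2 + ((θ / N : ℝ) : AddCircle (1 : ℝ))), N • r.2)‖ := by
    intro r
    have hder : ∀ θ : ℝ, HasDerivAt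
        (fun θ : ℝ => G ((r.1, r.2 + ((θ / N : ℝ) : AddCircle (1 : ℝ))), N • r.2))
        (2 * Real.pi * Complex.I / N *
          H ((r.1, r.2 + ((θ / N : ℝ) : AddCircle (1 : ℝ))), N • r.2)) θ := by
      intro θ
      simp only [hG, hH, mul_sum]
      refine HasDerivAt.fun_sum fun i _ => ?_
      have h1 := ((hasDerivAt_fourier 1 (p i) (θ / N)).scomp θ
        ((hasDerivAt_id θ).div_const (N : ℝ))).const_mul
          (A i (r.1, N • r.2) * fourier (p i) r.2)
      have h2 : ∀ c : AddCircle (1 : ℝ), fourier (p i) (r.2 + c) =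
          fourier (p i) r.2 * fourier (p i) c := by
        intro c
        rw [fourier_apply, fourier_apply, fourier_apply, smul_add, AddCircle.toCircle_add]
        push_cast; rfl
      simp only [h2]
      refine (h1.congr_deriv ?_).congr_of_eventuallyEq (.of_forall fun t => ?_)
      · simp only [Complex.real_smul]; push_cast; ring
      · simp [mul_assoc]
    have h3 := abs_norm_sub_integral_norm_le hder (by fun_prop)
    simp only [zero_div, AddCircle.coe_zero, add_zero, norm_mul,
      intervalIntegral.integral_const_mul] at h3
    refine h3.trans_eq ?_
    simp [abs_of_pos Real.pi_pos]
    ring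
  calc |(∫ r : Y × AddCircle (1 : ℝ), ‖G (r, N • r.2)‖) - ∫ q, ‖G q‖|
      = |∫ r : Y × AddCircle (1 : ℝ), (‖G (r, N • r.2)‖ - ∫ θ in (-1 / 2 : ℝ)..(1 / 2),
        ‖G ((r.1, r.2 + ((θ / N : ℝ) : AddCircle (1 : ℝ))), N • r.2)‖)| := by
        rw [integral_sub (integrable_of_continuous_of_compactSpace (by fun_prop)) (hint_avg hGc.norm),
          integral_diagonal_average hN hGc.norm]
    _ ≤ ∫ r : Y × AddCircle (1 : ℝ), Real.pi / N * ∫ θ in (-1 / 2 : ℝ)..(1 / 2),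
        ‖H ((r.1, r.2 + ((θ / N : ℝ) : AddCircle (1 : ℝ))), N • r.2)‖ := by
        refine abs_integral_le_integral_abs.trans (integral_mono
          ((Integrable.sub (integrable_of_continuous_of_compactSpace (by fun_prop))
            (hint_avg hGc.norm)).abs) ((hint_avg hHc.norm).const_mul _) hpt)
    _ = Real.pi / N * ∫ q, ‖H q‖ := by
        rw [integral_const_mul, integral_diagonal_average hN hHc.norm]
    _ ≤ Real.pi / N * (s * ∫ q, ‖G q‖) := by gcongr
    _ = Real.pi * s / N * ∫ q, ‖G q‖ := by ring

end Transference

/-- for trigonometric polynomials `f_l, …, f_k` on `𝕋^d = 𝕋^{d-1} × 𝕋` (`l < k`)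
of degree at most `s` in the last variable, setting
`w_d(y',z) = ∑_j e^{2πiNjz} f_j(y',z)` and `w_{d+1}(y',z,y_d) = ∑_j e^{2πijy_d} f_j(y',z)`,
one has `(1 - 2(k-l+1)s/N) ‖w_{d+1}‖₁ ≤ ‖w_d‖₁ ≤ (1 + 2(k-l+1)s/N) ‖w_{d+1}‖₁`. -/
theorem stmt_5 (m : ℕ) (s N : ℕ) (hs : 0 < s) (hN : 0 < N) (l k : ℤ) (hlk : l < k)
    (f : ℤ → (Fin m → AddCircle (1 : ℝ)) × AddCircle (1 : ℝ) → ℂ)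
    (hpoly : ∀ j ∈ Finset.Icc l k,
      ∃ (Λ : Finset ((Fin m → ℤ) × ℤ)) (c : (Fin m → ℤ) × ℤ → ℂ),
        (∀ lam ∈ Λ, |lam.2| ≤ (s : ℤ)) ∧
        ∀ y' z, f j (y', z) =
          ∑ lam ∈ Λ, c lam * (∏ i, fourier (lam.1 i) (y' i)) * fourier lam.2 z)
    (wd : (Fin m → AddCircle (1 : ℝ)) × AddCircle (1 : ℝ) → ℂ)
    (hwd : ∀ y' z, wd (y', z) = ∑ j ∈ Finset.Icc l k, fourier ((N : ℤ) * j) z * f j (y', z))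
    (wd1 : ((Fin m → AddCircle (1 : ℝ)) × AddCircle (1 : ℝ)) × AddCircle (1 : ℝ) → ℂ)
    (hwd1 : ∀ y' z yd, wd1 ((y', z), yd) = ∑ j ∈ Finset.Icc l k, fourier j yd * f j (y', z)) :
    (1 - 2 * ((k : ℝ) - l + 1) * s / N) *
        (∫ q : ((Fin m → AddCircle (1 : ℝ)) × AddCircle (1 : ℝ)) × AddCircle (1 : ℝ), ‖wd1 q‖) ≤
      (∫ p : (Fin m → AddCircle (1 : ℝ)) × AddCircle (1 : ℝ), ‖wd p‖) ∧
    (∫ p : (Fin m → AddCircle (1 : ℝ)) × AddCircle (1 : ℝ), ‖wd p‖) ≤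
      (1 + 2 * ((k : ℝ) - l + 1) * s / N) *
        (∫ q : ((Fin m → AddCircle (1 : ℝ)) × AddCircle (1 : ℝ)) × AddCircle (1 : ℝ), ‖wd1 q‖) := by
  choose! Λ c hΛ hf using hpoly
  have hwd1' : ∀ q, wd1 q = ∑ i ∈ (Finset.Icc l k).sigma Λ,
      (fourier i.1 q.2 * (c i.1 i.2 * ∏ a, fourier (i.2.1 a) (q.1.1 a))) *
        fourier i.2.2 q.1.2 := by
    rintro ⟨⟨y', z⟩, u⟩
    rw [hwd1, sum_sigma]
    refine sum_congr rfl fun j hj => ?_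
    rw [hf j hj, mul_sum]
    exact sum_congr rfl fun lam _ => by ring
  have hdiag : ∀ r, wd r = wd1 (r, N • r.2) := by
    rintro ⟨y', z⟩
    rw [hwd, hwd1]
    refine sum_congr rfl fun j _ => ?_
    rw [fourier_apply, fourier_apply, mul_comm (N : ℤ) j, mul_smul, natCast_zsmul]
  have key := abs_integral_norm_diagonal_sub_le hs hN ((Finset.Icc l k).sigma Λ)
    (Y := Fin m → AddCircle (1 : ℝ))
    (A := fun i r => fourier i.1 r.2 * (c i.1 i.2 * ∏ a, fourier (i.2.1 a) (r.1 a)))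
    (fun i => by fun_prop) (p := fun i => i.2.2)
    (fun i hi => hΛ i.1 (mem_sigma.mp hi).1 i.2 (mem_sigma.mp hi).2) hwd1'
  simp only [← hdiag] at key
  have hW : 0 ≤ ∫ q, ‖wd1 q‖ := integral_nonneg fun _ => norm_nonneg _
  have hconst : Real.pi * s / N ≤ 2 * ((k : ℝ) - l + 1) * s / N := by
    have hkl : (l : ℝ) + 1 ≤ k := by exact_mod_cast hlk
    gcongr
    linarith [Real.pi_le_four]
  obtain ⟨h1, h2⟩ := abs_le.mp (key.trans (mul_le_mul_of_nonneg_right hconst hW))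
  constructor <;> linarith
end

section
/- Let $N$ be a positive integer, $l \le k$ integers, and for each $j$ with $l \le j \le k$ let $g_j : \mathbb{T}^{d-1} \times \mathbb{T} \to \mathbb{C}$ be an integrable function which, for every fixed $y' \in \mathbb{T}^{d-1}$, is constant in the last variable on each interval $I_m = [m/N, (m+1)/N)$, $m = 0, 1, \ldots, N-1$ (i.e. $g_j(y', z) = h_j(\lfloor N z \rfloor, y')$ for some functions $h_j$). Then $\int_{\mathbb{T}^{d-1}} \int_{\mathbb{T}} \Big| \sum_{j=l}^{k} e^{2\pi i j N z} g_j(y', z) \Big| \, dz \, dy' = \int_{\mathbb{T}^{d-1}} \int_{\mathbb{T}} \int_{\mathbb{T}} \Big| \sum_{j=l}^{k} e^{2\pi i j y_d} g_j(y', z) \Big| \, dy_d \, dz \, dy'$; that is, $\|\bar{w}_d\|_{L^1(\mathbb{T}^d)} = \|\tilde{w}_{d+1}\|_{L^1(\mathbb{T}^{d+1})}$ where $\bar{w}_d(y',z) = \sum_{j=l}^{k} e^{2\pi i j N z} g_j(y',z)$ and $\tilde{w}_{d+1}(y', y_d, z) = \sum_{j=l}^{k} e^{2\pi i j y_d} g_j(y',z)$.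 -/
open MeasureTheory Finset

/-- The canonical representative in `[0,1)` of a point of the torus `𝕋 = ℝ/ℤ`. -/
noncomputable def torusRep (z : AddCircle (1 : ℝ)) : ℝ :=
  (AddCircle.equivIco 1 0 z : ℝ)

/-- A function of the form `z ↦ G ⌊N z⌋ (N z)` on the torus integrates to the average over
`n < N` of the integrals of the `G n`. -/
theorem integral_floor_nsmul {N : ℕ} (hN : 0 < N) (G : ℤ → AddCircle (1 : ℝ) → ℝ)
    (hG : ∀ n, Continuous (G n)) :
    ∫ z : AddCircle (1 : ℝ), G ⌊(N : ℝ) * torusRep z⌋ (N • z) =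
      (N : ℝ)⁻¹ * ∑ n ∈ range N, ∫ t : AddCircle (1 : ℝ), G n t := by
  have hN0 : (N : ℝ) ≠ 0 := by exact_mod_cast hN.ne'
  have hfloor (n : ℕ) : Set.EqOn (fun u : ℝ ↦ G n u) (fun u : ℝ ↦ G ⌊u⌋ u)
      (Set.uIoo (n : ℝ) ((n + 1 : ℕ) : ℝ)) := by
    intro u hu
    rw [Set.uIoo_of_le (by simp)] at hu
    have : ⌊u⌋ = (n : ℤ) := by
      rw [Int.floor_eq_iff]
      exact ⟨by exact_mod_cast hu.1.le, by exact_mod_cast hu.2⟩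
    simp only [this]
  calc ∫ z : AddCircle (1 : ℝ), G ⌊(N : ℝ) * torusRep z⌋ (N • z)
      = ∫ x in (0 : ℝ)..1, G ⌊(N : ℝ) * x⌋ ((N * x : ℝ) : AddCircle (1 : ℝ)) := by
        rw [← AddCircle.intervalIntegral_preimage 1 0, zero_add]
        refine intervalIntegral.integral_congr_Ioo_of_le zero_le_one fun x hx ↦ ?_
        have hrep : torusRep (x : AddCircle (1 : ℝ)) = x :=
          AddCircle.equivIco_coe_of_mem ⟨hx.1.le, by simpa using hx.2⟩
        simp only [hrep, ← nsmul_eq_mul, AddCircle.coe_nsmul]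
    _ = (N : ℝ)⁻¹ * ∫ u in ((0 : ℕ) : ℝ)..(N : ℝ), G ⌊u⌋ u := by
        rw [intervalIntegral.integral_comp_mul_left
          (fun u : ℝ ↦ G ⌊u⌋ (u : AddCircle (1 : ℝ))) hN0]
        simp
    _ = (N : ℝ)⁻¹ * ∑ n ∈ range N, ∫ t : AddCircle (1 : ℝ), G n t := by
        rw [← intervalIntegral.sum_integral_adjacent_intervals (a := fun n : ℕ ↦ (n : ℝ))
          fun n _ ↦ (((hG n).comp (AddCircle.continuous_mk' 1)).intervalIntegrable _ _).congr_uIoo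
            (hfloor n)]
        congr 1
        refine Finset.sum_congr rfl fun n _ ↦ ?_
        rw [← intervalIntegral.integral_congr_uIoo (hfloor n), Nat.cast_succ,
          AddCircle.intervalIntegral_preimage 1 n (G n)]

/-- On the torus, the fast variable `N z` decouples from the slow variable `⌊N z⌋`. -/
theorem integral_floor_nsmul_eq_integral_integral {N : ℕ} (hN : 0 < N)
    (G : ℤ → AddCircle (1 : ℝ) → ℝ) (hG : ∀ n, Continuous (G n)) :
    ∫ z : AddCircle (1 : ℝ), G ⌊(N : ℝ) * torusRep z⌋ (N • z) =
      ∫ z : AddCircle (1 : ℝ), ∫ t : AddCircle (1 : ℝ), G ⌊(N : ℝ) * torusRep z⌋ t := by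
  rw [integral_floor_nsmul hN G hG,
    integral_floor_nsmul hN (fun n _ ↦ ∫ t, G n t) fun _ ↦ continuous_const]
  simp [measureReal_def]

/-- The norm of a sum of integrable functions with Fourier-mode coefficients is integrable. -/
theorem integrable_norm_sum_fourier_mul {X ι : Type*} [MeasurableSpace X] {μ : Measure X}
    (s : Finset ι) (a : ι → ℤ) {φ : X → AddCircle (1 : ℝ)} (hφ : Measurable φ) {f : ι → X → ℂ}
    (hf : ∀ j ∈ s, Integrable (f j) μ) :
    Integrable (fun x ↦ ‖∑ j ∈ s, fourier (a j) (φ x) * f j x‖) μ := by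
  refine (integrable_finsetSum s fun j hj ↦ (hf j hj).bdd_mul (c := 1) ?_ ?_).norm
  · exact ((map_continuous (fourier (a j))).measurable.comp hφ).aestronglyMeasurable
  · exact .of_forall fun x ↦ (Circle.norm_coe _).le

/-- if each integrable `g_j : 𝕋^{d-1} × 𝕋 → ℂ` is, in the last variable, constant
on each interval `I_m = [m/N, (m+1)/N)`, then
`‖∑_j e^{2πijNz} g_j(y',z)‖_{L¹(𝕋^d)} = ‖∑_j e^{2πijy_d} g_j(y',z)‖_{L¹(𝕋^{d+1})}`. -/
theorem stmt_6 (m : ℕ) (N : ℕ) (hN : 0 < N) (l k : ℤ) (hlk : l ≤ k)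
    (g : ℤ → (Fin m → AddCircle (1 : ℝ)) × AddCircle (1 : ℝ) → ℂ)
    (hint : ∀ j ∈ Finset.Icc l k, Integrable (g j) volume)
    (hstep : ∀ j ∈ Finset.Icc l k, ∀ (y' : Fin m → AddCircle (1 : ℝ)) (z : AddCircle (1 : ℝ)),
      g j (y', z) =
        g j (y', (((⌊(N : ℝ) * torusRep z⌋ : ℝ) / N : ℝ) : AddCircle (1 : ℝ)))) :
    (∫ p : (Fin m → AddCircle (1 : ℝ)) × AddCircle (1 : ℝ),
        ‖∑ j ∈ Finset.Icc l k, fourier (j * (N : ℤ)) p.2 * g j p‖) =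
      ∫ q : ((Fin m → AddCircle (1 : ℝ)) × AddCircle (1 : ℝ)) × AddCircle (1 : ℝ),
        ‖∑ j ∈ Finset.Icc l k, fourier j q.2 * g j q.1‖ := by
  have hL := integrable_norm_sum_fourier_mul (Icc l k) (fun j ↦ j * (N : ℤ)) measurable_snd hint
  have hR := integrable_norm_sum_fourier_mul (Icc l k) (fun j ↦ j)
    (measurable_snd (α := (Fin m → AddCircle (1 : ℝ)) × AddCircle (1 : ℝ)))
    fun j hj ↦ (hint j hj).comp_fst (volume : Measure (AddCircle (1 : ℝ)))
  refine (integral_prod _ hL).trans <| Eq.trans ?_ (integral_prod _ hR).symm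
  refine Eq.trans ?_ (integral_prod _ hR.integral_prod_left).symm
  refine integral_congr_ae <| .of_forall fun y ↦ ?_
  let G (n : ℤ) (t : AddCircle (1 : ℝ)) : ℝ :=
    ‖∑ j ∈ Icc l k, fourier j t * g j (y, (((n : ℝ) / N : ℝ) : AddCircle (1 : ℝ)))‖
  have hG (n : ℤ) : Continuous (G n) := by fun_prop
  have hGg (z t : AddCircle (1 : ℝ)) :
      ‖∑ j ∈ Icc l k, fourier j t * g j (y, z)‖ = G ⌊(N : ℝ) * torusRep z⌋ t :=
    congrArg norm <| Finset.sum_congr rfl fun j hj ↦ by rw [hstep j hj y z]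
  have hfourier (j : ℤ) (z : AddCircle (1 : ℝ)) :
      (fourier (j * (N : ℤ)) z : ℂ) = fourier j (N • z) := by
    simp only [fourier_apply, mul_smul, natCast_zsmul]
  simp only [hfourier, hGg]
  exact integral_floor_nsmul_eq_integral_integral hN G hG
end

section
/- Let $(a_j)_{j \ge 1}$ and $(\tau_j)_{j \ge 1}$ be sequences of positive integers satisfying $\tau_{j+1} \ge 3 a_j \tau_j$ for all $j$ and $S := \sum_{j=1}^{\infty} \frac{a_j \tau_j a_{j+1}}{\tau_{j+1}} < \infty$. Then for every $n \ge 2$, $\sum_{m=1}^{n-1} 4\, a_{m+1}\, \frac{\sum_{j=1}^{m} a_j \tau_j}{\tau_{m+1}} \le 6\, S$; in particular the quantities $K(d) = 4\, a_{n-d+1} \frac{\sum_{j=1}^{n-d} a_j \tau_j}{\tau_{n-d+1}}$, $d = 1, \ldots, n-1$, satisfy $\sum_{d=1}^{n-1} K(d) \le 6 S$ uniformly in $n$. -/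
open Finset

/-- Under the growth condition `3 a_j τ_j ≤ τ_{j+1}`, the partial sums of `a_j τ_j` are at most
`3 / 2` times their last term. -/
theorem two_mul_sum_range_succ_le (a τ : ℕ → ℕ) (ha : ∀ j, 0 < a j)
    (hgrow : ∀ j, 3 * a j * τ j ≤ τ (j + 1)) (m : ℕ) :
    2 * ∑ j ∈ range (m + 1), a j * τ j ≤ 3 * (a m * τ m) := by
  induction m with
  | zero => simp only [zero_add, sum_range_one]; lia
  | succ m ih =>
    rw [sum_range_succ]
    have hlast : τ (m + 1) ≤ a (m + 1) * τ (m + 1) := Nat.le_mul_of_pos_left _ (ha _)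
    have hstep := hgrow m
    rw [mul_assoc] at hstep
    lia

/-- sequences indexed from `0`: under the lacunarity condition and
`S = ∑ a_j τ_j a_{j+1} / τ_{j+1} < ∞`, the quantities
`K(d) = 4 a_{n-d+1} (∑_{j≤n-d} a_j τ_j) / τ_{n-d+1}` satisfy `∑_{d=1}^{n-1} K(d) ≤ 6 S`
uniformly in `n`; equivalently `∑_{m=1}^{n-1} 4 a_{m+1} (∑_{j=1}^m a_j τ_j)/τ_{m+1} ≤ 6 S`. -/
theorem stmt_9 (a τ : ℕ → ℕ) (ha : ∀ j, 0 < a j) (hτ : ∀ j, 0 < τ j)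
    (hgrow : ∀ j, 3 * a j * τ j ≤ τ (j + 1))
    (hS : Summable fun j => (a j * τ j * a (j + 1) : ℝ) / (τ (j + 1) : ℝ)) :
    ∀ n : ℕ, 2 ≤ n →
      (∑ m ∈ Finset.range (n - 1),
          4 * (a (m + 1) : ℝ) * (∑ j ∈ Finset.range (m + 1), (a j : ℝ) * τ j) / τ (m + 1)) ≤
        6 * ∑' j, (a j * τ j * a (j + 1) : ℝ) / (τ (j + 1) : ℝ) := by
  intro n _
  refine le_trans ?_ (mul_le_mul_of_nonneg_left
    (hS.sum_le_tsum (range (n - 1)) fun j _ => by positivity) (by norm_num))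
  rw [mul_sum]
  refine sum_le_sum fun m _ => ?_
  have hsum : 2 * ∑ j ∈ range (m + 1), (a j : ℝ) * τ j ≤ 3 * (a m * τ m) := by
    exact_mod_cast two_mul_sum_range_succ_le a τ ha hgrow m
  rw [← mul_div_assoc]
  gcongr ?_ / _
  nlinarith [mul_le_mul_of_nonneg_left hsum (Nat.cast_nonneg (α := ℝ) (a (m + 1)))]
end
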